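/- Let p = 5, let q be a power of 5, and let n ≥ 2 and d ≥ 1 be integers. The polynomial 𝖤_{n,d} ∈ 𝔽_q[x] is a Dembowski–Ostrom polynomial if and only if one of the following holds: (i) n ∈ {2, 3} and d = 5^k·(5^α + 1) for some α, k ≥ 0; (ii) n = 7 and d = 2·5^k for some k ≥ 0. -/

import Mathlib

open Polynomial Finset

/-- A Dembowski–Ostrom polynomial in characteristic `p`: every exponent occurring with a
nonzero coefficient is of the form `p^i + p^j` for nonnegative integers `i, j`. -/
def IsDOPoly (p : ℕ) {F : Type*} [Field F] (f : F[X]) : Prop :=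
  ∀ k ∈ f.support, ∃ i j : ℕ, k = p ^ i + p ^ j

/-- The integer coefficient `(n/(n-i)) * binom(n-i, i)` of the reversed Dickson
polynomial of the first kind (the natural division is exact). -/
def dicksonCoeff (n i : ℕ) : ℕ := n * (n - i).choose i / (n - i)

/-- `𝒟_{n,d} = D_n(1, x^d) - D_n(1, 0)` over `F`, i.e.
`∑_{i=1}^{⌊n/2⌋} (n/(n-i))·binom(n-i,i)·(-1)^i·x^{d·i}`. -/
noncomputable def DD (F : Type*) [Field F] (n d : ℕ) : F[X] :=
  ∑ i ∈ Finset.Icc 1 (n / 2), C ((-1 : F) ^ i * (dicksonCoeff n i : F)) * X ^ (d * i)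

/-- `𝖤_{n,d} = E_n(1, x^d) - E_n(1, 0)` over `F`, i.e.
`∑_{i=1}^{⌊n/2⌋} binom(n-i,i)·(-1)^i·x^{d·i}`. -/
noncomputable def EE (F : Type*) [Field F] (n d : ℕ) : F[X] :=
  ∑ i ∈ Finset.Icc 1 (n / 2), C ((-1 : F) ^ i * ((n - i).choose i : F)) * X ^ (d * i)

/-- The reversed Dickson polynomial of the first kind `D_n(a, x)`, as a function on `F`. -/
def revDicksonFst {F : Type*} [Field F] (n : ℕ) (a x : F) : F :=
  ∑ i ∈ Finset.range (n / 2 + 1), (dicksonCoeff n i : F) * (-x) ^ i * a ^ (n - 2 * i)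

/-- The reversed Dickson polynomial of the second kind `E_n(a, x)`, as a function on `F`. -/
def revDicksonSnd {F : Type*} [Field F] (n : ℕ) (a x : F) : F :=
  ∑ i ∈ Finset.range (n / 2 + 1), ((n - i).choose i : F) * (-x) ^ i * a ^ (n - 2 * i)

/-- `D_n(1, x)` as a one-variable polynomial over `F`. -/
noncomputable def revDicksonFstPoly (F : Type*) [Field F] (n : ℕ) : F[X] :=
  ∑ i ∈ Finset.range (n / 2 + 1), C ((-1 : F) ^ i * (dicksonCoeff n i : F)) * X ^ i

/-- The Dembowski–Ostrom condition on `EE F n d` in terms of binomial coefficients. -/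
lemma isDOPoly_EE_iff {F : Type*} [Field F] (p : ℕ) [CharP F p] (n : ℕ) {d : ℕ} (hd : 1 ≤ d) :
    IsDOPoly p (EE F n d) ↔ ∀ i, 1 ≤ i → 2 * i ≤ n → ¬ p ∣ (n - i).choose i →
      ∃ a b : ℕ, d * i = p ^ a + p ^ b := by
  have key : ∀ k, (EE F n d).coeff k = ∑ i ∈ Finset.Icc 1 (n / 2),
      if k = d * i then (-1 : F) ^ i * ((n - i).choose i : F) else 0 := by
    intro k
    simp only [EE, finsetSum_coeff, coeff_C_mul, coeff_X_pow, mul_ite, mul_one, mul_zero]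
  constructor
  · intro h i h1 h2 h3
    refine h (d * i) ?_
    rw [mem_support_iff, key, Finset.sum_eq_single i]
    · rw [if_pos rfl]
      refine mul_ne_zero (pow_ne_zero _ (neg_ne_zero.2 one_ne_zero)) ?_
      rwa [Ne, CharP.cast_eq_zero_iff F p]
    · intro j _ hj
      exact if_neg fun h => hj (Nat.eq_of_mul_eq_mul_left hd h).symm
    · intro hi
      exact absurd (Finset.mem_Icc.2 ⟨h1, by omega⟩) hi
  · intro h k hk
    rw [mem_support_iff, key] at hk
    obtain ⟨i, hi, hne⟩ := Finset.exists_ne_zero_of_sum_ne_zero hk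
    rw [Finset.mem_Icc] at hi
    have hki : k = d * i := by
      by_contra hki
      exact hne (if_neg hki)
    rw [if_pos hki] at hne
    rw [hki]
    refine h i hi.1 (by omega) fun hdvd => hne ?_
    rw [(CharP.cast_eq_zero_iff F p _).2 hdvd, mul_zero]

lemma exists_eq_pow_mul_pow_add_one {p x a b : ℕ} (h : x = p ^ a + p ^ b) :
    ∃ k α, x = p ^ k * (p ^ α + 1) := by
  rcases le_total a b with hab | hab
  · obtain ⟨c, rfl⟩ := Nat.exists_eq_add_of_le hab
    exact ⟨a, c, by rw [h]; ring⟩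
  · obtain ⟨c, rfl⟩ := Nat.exists_eq_add_of_le hab
    exact ⟨b, c, by rw [h]; ring⟩

lemma five_pow_eq_one_or_five_or_dvd (a : ℕ) : 5 ^ a = 1 ∨ 5 ^ a = 5 ∨ (25 ∣ 5 ^ a ∧ 0 < 5 ^ a) := by
  match a with
  | 0 => simp
  | 1 => simp
  | a + 2 => exact Or.inr (Or.inr ⟨⟨5 ^ a, by ring⟩, by positivity⟩)

lemma not_five_dvd_mul_five_pow_add_one {i : ℕ} (hi : ¬ 5 ∣ i) (a : ℕ) :
    ¬ 5 ∣ i * (5 ^ a + 1) := by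
  intro h
  rcases (Nat.Prime.dvd_mul Nat.prime_five).1 h with h | h
  · exact hi h
  · rcases five_pow_eq_one_or_five_or_dvd a with h' | h' | h' <;> omega

lemma pow_mul_cancel {p k l u v : ℕ} (hp : 0 < p) (hu : ¬ p ∣ u) (hv : ¬ p ∣ v)
    (h : p ^ k * u = p ^ l * v) : u = v := by
  rcases lt_trichotomy k l with hkl | rfl | hkl
  · obtain ⟨c, rfl⟩ := Nat.exists_eq_add_of_lt hkl
    refine absurd ⟨p ^ c * v, Nat.eq_of_mul_eq_mul_left (pow_pos hp k) (h.trans ?_)⟩ hu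
    ring
  · exact Nat.eq_of_mul_eq_mul_left (pow_pos hp k) h
  · obtain ⟨c, rfl⟩ := Nat.exists_eq_add_of_lt hkl
    refine absurd ⟨p ^ c * u, Nat.eq_of_mul_eq_mul_left (pow_pos hp l) (h.symm.trans ?_)⟩ hv
    ring

/-- Two multiples of `d` by integers prime to `5`, both sums of two powers of `5`, have `5`-free
parts in the ratio of the multipliers. -/
lemma exists_ratio_eq {d i j : ℕ} (hi : ¬ 5 ∣ i) (hj : ¬ 5 ∣ j)
    (h1 : ∃ a b : ℕ, d * i = 5 ^ a + 5 ^ b) (h2 : ∃ a b : ℕ, d * j = 5 ^ a + 5 ^ b) :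
    ∃ k α β : ℕ, d * i = 5 ^ k * (5 ^ α + 1) ∧ j * (5 ^ α + 1) = i * (5 ^ β + 1) := by
  obtain ⟨a, b, h1⟩ := h1
  obtain ⟨a', b', h2⟩ := h2
  obtain ⟨k, α, h1⟩ := exists_eq_pow_mul_pow_add_one h1
  obtain ⟨l, β, h2⟩ := exists_eq_pow_mul_pow_add_one h2
  refine ⟨k, α, β, h1, pow_mul_cancel (k := k) (l := l) (by norm_num : 0 < 5)
    (not_five_dvd_mul_five_pow_add_one hj α) (not_five_dvd_mul_five_pow_add_one hi β) ?_⟩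
  calc 5 ^ k * (j * (5 ^ α + 1)) = j * (5 ^ k * (5 ^ α + 1)) := by ring
    _ = i * (5 ^ l * (5 ^ β + 1)) := by rw [← h1, ← h2]; ring
    _ = 5 ^ l * (i * (5 ^ β + 1)) := by ring

lemma five_dvd_choose_iff (a b : ℕ) :
    5 ∣ a.choose b ↔ 5 ∣ (a % 5).choose (b % 5) * (a / 5).choose (b / 5) :=
  have := Fact.mk Nat.prime_five
  Nat.ModEq.dvd_iff Choose.choose_modEq_choose_mod_mul_choose_div_nat dvd_rfl

theorem stmt2 {F : Type*} [Field F] [Fintype F] (e : ℕ) (he : 0 < e)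
    (hcard : Fintype.card F = 5 ^ e) (n d : ℕ) (hn : 2 ≤ n) (hd : 1 ≤ d) :
    IsDOPoly 5 (EE F n d) ↔
      ((n = 2 ∨ n = 3) ∧ ∃ α k : ℕ, d = 5 ^ k * (5 ^ α + 1)) ∨
      (n = 7 ∧ ∃ k : ℕ, d = 2 * 5 ^ k) := by
  have := Fact.mk Nat.prime_five
  have : CharP F 5 := charP_of_card_eq_prime_pow hcard
  rw [isDOPoly_EE_iff 5 n hd]
  constructor
  · intro h
    have small : ∀ i, 1 ≤ i → i < 5 → 2 * i ≤ n → ¬ 5 ∣ ((n - i) % 5).choose i →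
        ∃ a b : ℕ, d * i = 5 ^ a + 5 ^ b := by
      intro i h1 h2 h3 h4
      refine h i h1 h3 ?_
      rwa [five_dvd_choose_iff, Nat.mod_eq_of_lt h2, Nat.div_eq_of_lt h2, Nat.choose_zero_right,
        mul_one]
    have one_of (hn : n % 5 ≠ 1) : ∃ a b : ℕ, d * 1 = 5 ^ a + 5 ^ b :=
      small 1 le_rfl (by norm_num) (by omega) (by rw [Nat.choose_one_right]; omega)
    by_cases h23 : n = 2 ∨ n = 3
    · obtain ⟨a, b, hab⟩ := one_of (by omega)
      obtain ⟨k, α, hk⟩ := exists_eq_pow_mul_pow_add_one hab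
      exact Or.inl ⟨h23, α, k, by rw [← hk, mul_one]⟩
    have hmod : n % 5 = 0 ∨ n % 5 = 1 ∨ n % 5 = 2 ∨ n % 5 = 3 ∨ n % 5 = 4 := by omega
    rcases hmod with hm | hm | hm | hm | hm
    · have h2 := small 2 (by norm_num) (by norm_num) (by omega)
        (by rw [show (n - 2) % 5 = 3 by omega]; decide)
      have h1 := one_of (by omega)
      obtain ⟨k, α, β, -, hr⟩ := exists_ratio_eq (by norm_num) (by norm_num) h1 h2
      rcases five_pow_eq_one_or_five_or_dvd α with h' | h' | h' <;>
        rcases five_pow_eq_one_or_five_or_dvd β with h'' | h'' | h'' <;> omega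
    · have h2 := small 2 (by norm_num) (by norm_num) (by omega)
        (by rw [show (n - 2) % 5 = 4 by omega]; decide)
      have h3 := small 3 (by norm_num) (by norm_num) (by omega)
        (by rw [show (n - 3) % 5 = 3 by omega]; decide)
      obtain ⟨k, α, β, -, hr⟩ := exists_ratio_eq (by norm_num) (by norm_num) h2 h3
      rcases five_pow_eq_one_or_five_or_dvd α with h' | h' | h' <;>
        rcases five_pow_eq_one_or_five_or_dvd β with h'' | h'' | h'' <;> omega
    · have h3 := small 3 (by norm_num) (by norm_num) (by omega)
        (by rw [show (n - 3) % 5 = 4 by omega]; decide)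
      by_cases h7 : n = 7
      · have h1 := one_of (by omega)
        obtain ⟨k, α, β, hk, hr⟩ := exists_ratio_eq (by norm_num) (by norm_num) h1 h3
        have hα : 5 ^ α = 1 := by
          rcases five_pow_eq_one_or_five_or_dvd α with h' | h' | h' <;>
            rcases five_pow_eq_one_or_five_or_dvd β with h'' | h'' | h'' <;> omega
        rw [hα] at hk
        exact Or.inr ⟨h7, k, by omega⟩
      by_cases h1 : n / 5 % 5 = 1
      · have h11 := h 11 (by norm_num) (by omega) (by
          rw [five_dvd_choose_iff, show (n - 11) % 5 = 1 by omega]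
          simp only [Nat.reduceMod, Nat.reduceDiv, Nat.choose_one_right, one_mul]
          rw [five_dvd_choose_iff, show (n - 11) / 5 % 5 = 4 by omega]
          simp [Nat.choose])
        obtain ⟨k, α, β, -, hr⟩ := exists_ratio_eq (by norm_num) (by norm_num) h3 h11
        rcases five_pow_eq_one_or_five_or_dvd α with h' | h' | h' <;>
          rcases five_pow_eq_one_or_five_or_dvd β with h'' | h'' | h'' <;> omega
      · have h6 := h 6 (by norm_num) (by omega) (by
          rw [five_dvd_choose_iff, show (n - 6) % 5 = 1 by omega]
          simp only [Nat.reduceMod, Nat.reduceDiv, Nat.choose_one_right, one_mul]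
          omega)
        obtain ⟨k, α, β, -, hr⟩ := exists_ratio_eq (by norm_num) (by norm_num) h3 h6
        rcases five_pow_eq_one_or_five_or_dvd α with h' | h' | h' <;>
          rcases five_pow_eq_one_or_five_or_dvd β with h'' | h'' | h'' <;> omega
    · have h4 := small 4 (by norm_num) (by norm_num) (by omega)
        (by rw [show (n - 4) % 5 = 4 by omega]; decide)
      have h1 := one_of (by omega)
      obtain ⟨k, α, β, -, hr⟩ := exists_ratio_eq (by norm_num) (by norm_num) h1 h4
      rcases five_pow_eq_one_or_five_or_dvd α with h' | h' | h' <;>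
        rcases five_pow_eq_one_or_five_or_dvd β with h'' | h'' | h'' <;> omega
    · have h2 := small 2 (by norm_num) (by norm_num) (by omega)
        (by rw [show (n - 2) % 5 = 2 by omega]; decide)
      have h1 := one_of (by omega)
      obtain ⟨k, α, β, -, hr⟩ := exists_ratio_eq (by norm_num) (by norm_num) h1 h2
      rcases five_pow_eq_one_or_five_or_dvd α with h' | h' | h' <;>
        rcases five_pow_eq_one_or_five_or_dvd β with h'' | h'' | h'' <;> omega
  · rintro (⟨hn', α, k, rfl⟩ | ⟨rfl, k, rfl⟩) i h1 h2 h3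
    · obtain rfl : i = 1 := by omega
      exact ⟨k + α, k, by ring⟩
    · have hi : i = 1 ∨ i = 2 ∨ i = 3 := by omega
      rcases hi with rfl | rfl | rfl
      · exact ⟨k, k, by ring⟩
      · exact absurd (by decide) h3
      · exact ⟨k + 1, k, by ring⟩
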